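/- Let f and g be Poisson forms on an exact multisymplectic manifold (P, θ, ω) with Hamiltonian multi-vector fields X_f and X_g of degrees r and s. Then the Poisson bracket is graded antisymmetric: {f,g} = −(−1)^{(r−1)(s−1)} {g,f}. -/

import Mathlib

/-- The sign `(-1)^e` for an integer exponent `e`. -/
def msign (e : ℤ) : ℤ := (((-1 : ℤˣ) ^ e : ℤˣ) : ℤ)

/-- An abstract Cartan calculus on a manifold `P`: an additive group `Form` of
differential forms and an additive group `MV` of multi-vector fields on `P`,
together with the exterior derivative `d`, the interior product (contraction)
`ι`, the exterior product `wedge` and the Schouten bracket `schouten` of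
multi-vector fields, and a predicate `hasDeg X r` expressing that `X` is a
multi-vector field of tensor degree `r`.  The Schouten bracket is the
extension of the Lie bracket of vector fields characterised by graded
antisymmetry and the graded Leibniz rule. -/
structure MVCalculus (Form MV : Type*) [AddCommGroup Form] [AddCommGroup MV] where
  d : Form →+ Form
  ι : MV → Form →+ Form
  wedge : MV → MV → MV
  schouten : MV → MV → MV
  hasDeg : MV → ℤ → Prop
  d_squared : ∀ f : Form, d (d f) = 0
  wedge_deg : ∀ {X Y : MV} {r s : ℤ}, hasDeg X r → hasDeg Y s → hasDeg (wedge X Y) (r + s)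
  schouten_deg : ∀ {X Y : MV} {r s : ℤ}, hasDeg X r → hasDeg Y s →
    hasDeg (schouten X Y) (r + s - 1)
  ι_wedge : ∀ (X Y : MV) (f : Form), ι (wedge X Y) f = ι Y (ι X f)
  ι_comm : ∀ {X Y : MV} {r s : ℤ}, hasDeg X r → hasDeg Y s →
    ∀ f : Form, ι X (ι Y f) = msign (r * s) • ι Y (ι X f)
  schouten_antisymm : ∀ {X Y : MV} {r s : ℤ}, hasDeg X r → hasDeg Y s →
    schouten Y X = - msign ((r - 1) * (s - 1)) • schouten X Y
  schouten_leibniz : ∀ {X : MV} {r s : ℤ} (Y Z : MV), hasDeg X r → hasDeg Y s →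
    schouten X (wedge Y Z)
      = wedge (schouten X Y) Z + msign ((r - 1) * s) • wedge Y (schouten X Z)

/-- The Lie derivative `L_X = d ∘ i(X) − (−1)^r i(X) ∘ d` of differential
forms along an `r`-multi-vector field `X`. -/
def MVCalculus.lie {Form MV : Type*} [AddCommGroup Form] [AddCommGroup MV]
    (C : MVCalculus Form MV) (r : ℤ) (X : MV) (f : Form) : Form :=
  C.d (C.ι X f) - msign r • C.ι X (C.d f)

/-- An exact multisymplectic manifold `(P, θ, ω)`: an `n`-form `θ`, the
multisymplectic `(n+1)`-form `ω = −dθ`, non-degenerate on vector fields,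
together with the scaling (Euler) vector field `Σ` satisfying `i(Σ)ω = −θ`. -/
structure ExactMultisymplectic (Form MV : Type*) [AddCommGroup Form] [AddCommGroup MV]
    extends MVCalculus Form MV where
  θ : Form
  ω : Form
  Sgm : MV
  Sgm_deg : hasDeg Sgm 1
  ω_eq : ω = - d θ
  Sgm_contract : ι Sgm ω = - θ
  nondeg : ∀ v : MV, hasDeg v 1 → ι v ω = 0 → v = 0

namespace ExactMultisymplectic

variable {Form MV : Type*} [AddCommGroup Form] [AddCommGroup MV]

/-- `J(X) = (−1)^r i(X) θ` for an `r`-multi-vector field `X`. -/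
def J (P : ExactMultisymplectic Form MV) (r : ℤ) (X : MV) : Form :=
  msign r • P.ι X P.θ

/-- `X` is a Hamiltonian multi-vector field associated to the Hamiltonian form
`f`, i.e. `i(X)ω = df`. -/
def IsHamiltonianPair (P : ExactMultisymplectic Form MV) (f : Form) (X : MV) : Prop :=
  P.ι X P.ω = P.d f

/-- `X` is an exact Hamiltonian `r`-multi-vector field, i.e. `L_X θ = 0`. -/
def IsExactHamiltonian (P : ExactMultisymplectic Form MV) (r : ℤ) (X : MV) : Prop :=
  P.toMVCalculus.lie r X P.θ = 0

/-- `f` is a Poisson form: a Hamiltonian form such that `i(Y)ω = 0` implies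
`i(Y)f = 0` for all multi-vector fields `Y` on `P`. -/
def IsPoisson (P : ExactMultisymplectic Form MV) (f : Form) : Prop :=
  (∃ X : MV, P.IsHamiltonianPair f X) ∧ ∀ Y : MV, P.ι Y P.ω = 0 → P.ι Y f = 0

/-- The Poisson bracket of Poisson forms `f`, `g` with Hamiltonian
multi-vector fields `X_f`, `X_g` of degrees `r`, `s`:
`{f,g} = −L_{X_f} g + (−1)^{(r−1)(s−1)} L_{X_g} f − (−1)^{(r−1)s} L_{X_f∧X_g} θ`. -/
def pb (P : ExactMultisymplectic Form MV) (r s : ℤ) (Xf Xg : MV) (f g : Form) : Form :=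
  - P.toMVCalculus.lie r Xf g + msign ((r - 1) * (s - 1)) • P.toMVCalculus.lie s Xg f
    - msign ((r - 1) * s) • P.toMVCalculus.lie (r + s) (P.wedge Xf Xg) P.θ

end ExactMultisymplectic

theorem msign_add (a b : ℤ) : msign (a + b) = msign a * msign b := by
  simp [msign, zpow_add]

theorem msign_mul_self (a : ℤ) : msign a * msign a = 1 := by
  rw [msign, ← Units.val_mul, Int.units_mul_self, Units.val_one]

theorem msign_two_mul_add (k a : ℤ) : msign (2 * k + a) = msign a := by
  rw [two_mul, msign_add, msign_add, msign_mul_self, one_mul]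

theorem msign_sub_one (a : ℤ) : msign (a - 1) = -msign a := by
  simp [msign, zpow_sub]

/-- The Lie derivative along an exterior product is graded commutative in the factors. -/
theorem MVCalculus.lie_wedge_comm {Form MV : Type*} [AddCommGroup Form] [AddCommGroup MV]
    (C : MVCalculus Form MV) {X Y : MV} {r s : ℤ} (hX : C.hasDeg X r) (hY : C.hasDeg Y s)
    (f : Form) :
    C.lie (r + s) (C.wedge X Y) f = msign (r * s) • C.lie (s + r) (C.wedge Y X) f := by
  simp only [lie, C.ι_wedge, C.ι_comm hY hX, map_zsmul, smul_sub, mul_comm s r, add_comm s r]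
  rw [smul_comm (msign (r + s))]

/-- **Graded antisymmetry of the Poisson bracket.**
For Poisson forms `f`, `g` on an exact multisymplectic manifold `(P, θ, ω)`
with Hamiltonian multi-vector fields `X_f`, `X_g` of degrees `r`, `s`:
`{f,g} = −(−1)^{(r−1)(s−1)} {g,f}`. -/
theorem ExactMultisymplectic.pb_graded_antisymm
    {Form MV : Type*} [AddCommGroup Form] [AddCommGroup MV]
    (P : ExactMultisymplectic Form MV) (r s : ℤ) (Xf Xg : MV) (f g : Form)
    (hfP : P.IsPoisson f) (hgP : P.IsPoisson g)
    (hdf : P.hasDeg Xf r) (hdg : P.hasDeg Xg s)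
    (hHf : P.IsHamiltonianPair f Xf) (hHg : P.IsHamiltonianPair g Xg) :
    P.pb r s Xf Xg f g = - msign ((r - 1) * (s - 1)) • P.pb s r Xg Xf g f := by
  have hsign : msign ((r - 1) * s) * msign (r * s)
      = -(msign ((r - 1) * (s - 1)) * msign ((s - 1) * r)) := by
    rw [← msign_add, ← msign_add,
      show (r - 1) * s + r * s = 2 * (r * s - s) + s by ring,
      show (r - 1) * (s - 1) + (s - 1) * r = 2 * ((r - 1) * (s - 1)) + (s - 1) by ring,
      msign_two_mul_add, msign_two_mul_add, msign_sub_one, neg_neg]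
  simp only [pb]
  rw [P.toMVCalculus.lie_wedge_comm hdf hdg, smul_smul, hsign, mul_comm (s - 1) (r - 1)]
  simp only [smul_sub, smul_add, smul_neg, neg_smul, neg_mul, smul_smul, msign_mul_self, one_smul]
  abel
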